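/- Let k be a field and a = a_1 h^i a monomial in k[h^{±1}] with a_1 ∈ k^* and i ∈ ℤ. Then the generalized Weyl algebra k[h^{±1}](σ_inv, a) with σ_inv(h) = h^{-1} is isomorphic as a k-algebra to the skew Laurent ring k[v^{±1}][u^{±1}; σ] where σ(v) = v^{-1}; equivalently, to the group algebra k[G] of the group G = ℤ ⋊ ℤ (semidirect product with ℤ acting on ℤ by negation), i.e. the group generated by u and v subject to u v u^{-1} = v^{-1}. -/

import Mathlib

open LaurentPolynomial

/-- The defining relations of the degree-one generalized Weyl algebra `k[h^{±1}](σ, a)`: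
the generators `Sum.inl p` (for `p` a Laurent polynomial) give a copy of `k[h^{±1}]`,
and the generators `x = Sum.inr 0` and `y = Sum.inr 1` satisfy
`y x = a`, `x y = σ a`, `x r = σ(r) x` and `y r = σ⁻¹(r) y` for all `r ∈ k[h^{±1}]`. -/
inductive GWARel (k : Type*) [CommRing k] (σ : LaurentPolynomial k ≃ₐ[k] LaurentPolynomial k)
    (a : LaurentPolynomial k) :
    FreeAlgebra k (LaurentPolynomial k ⊕ Fin 2) →
      FreeAlgebra k (LaurentPolynomial k ⊕ Fin 2) → Prop
  | add (r s : LaurentPolynomial k) :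
      GWARel k σ a (FreeAlgebra.ι k (Sum.inl (r + s)))
        (FreeAlgebra.ι k (Sum.inl r) + FreeAlgebra.ι k (Sum.inl s))
  | mul (r s : LaurentPolynomial k) :
      GWARel k σ a (FreeAlgebra.ι k (Sum.inl (r * s)))
        (FreeAlgebra.ι k (Sum.inl r) * FreeAlgebra.ι k (Sum.inl s))
  | smul (c : k) (r : LaurentPolynomial k) :
      GWARel k σ a (FreeAlgebra.ι k (Sum.inl (c • r))) (c • FreeAlgebra.ι k (Sum.inl r))
  | one : GWARel k σ a (FreeAlgebra.ι k (Sum.inl 1)) 1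
  | xr (r : LaurentPolynomial k) :
      GWARel k σ a (FreeAlgebra.ι k (Sum.inr 0) * FreeAlgebra.ι k (Sum.inl r))
        (FreeAlgebra.ι k (Sum.inl (σ r)) * FreeAlgebra.ι k (Sum.inr 0))
  | yr (r : LaurentPolynomial k) :
      GWARel k σ a (FreeAlgebra.ι k (Sum.inr 1) * FreeAlgebra.ι k (Sum.inl r))
        (FreeAlgebra.ι k (Sum.inl (σ.symm r)) * FreeAlgebra.ι k (Sum.inr 1))
  | yx : GWARel k σ a (FreeAlgebra.ι k (Sum.inr 1) * FreeAlgebra.ι k (Sum.inr 0))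
        (FreeAlgebra.ι k (Sum.inl a))
  | xy : GWARel k σ a (FreeAlgebra.ι k (Sum.inr 0) * FreeAlgebra.ι k (Sum.inr 1))
        (FreeAlgebra.ι k (Sum.inl (σ a)))

/-- The degree-one generalized Weyl algebra `k[h^{±1}](σ, a)`, presented as the quotient of
the free algebra on `k[h^{±1}] ⊕ {x, y}` by the generalized Weyl relations. -/
abbrev GWA (k : Type*) [CommRing k] (σ : LaurentPolynomial k ≃ₐ[k] LaurentPolynomial k)
    (a : LaurentPolynomial k) :=
  RingQuot (GWARel k σ a)

namespace GWA

variable {k : Type*} [CommRing k] (σ : LaurentPolynomial k ≃ₐ[k] LaurentPolynomial k)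
  (a : LaurentPolynomial k)

/-- The copy of the Laurent polynomial `p` inside the generalized Weyl algebra. -/
noncomputable def r (p : LaurentPolynomial k) : GWA k σ a :=
  RingQuot.mkAlgHom k (GWARel k σ a) (FreeAlgebra.ι k (Sum.inl p))

/-- The element `h` of the generalized Weyl algebra. -/
noncomputable def H : GWA k σ a := r σ a (T 1)

/-- The element `h⁻¹` of the generalized Weyl algebra. -/
noncomputable def Hinv : GWA k σ a := r σ a (T (-1))

/-- The generator `x` of the generalized Weyl algebra. -/
noncomputable def x : GWA k σ a :=
  RingQuot.mkAlgHom k (GWARel k σ a) (FreeAlgebra.ι k (Sum.inr 0))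

/-- The generator `y` of the generalized Weyl algebra. -/
noncomputable def y : GWA k σ a :=
  RingQuot.mkAlgHom k (GWARel k σ a) (FreeAlgebra.ι k (Sum.inr 1))

end GWA

/-- An element `a ∈ k[h^{±1}]` is a monomial if `a = c·hⁱ` for some `c ∈ k`, `i ∈ ℤ`. -/
def LaurentPolynomial.IsMonomial {k : Type*} [CommRing k] (a : LaurentPolynomial k) : Prop :=
  ∃ (c : k) (i : ℤ), a = C c * T i

/-- The infinite group `⟨u, v | u v u⁻¹ = v⁻¹⟩ ≅ ℤ ⋊ ℤ`, realized as the semidirect product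
of `Multiplicative ℤ` (generated by `v`) with `Multiplicative ℤ` (generated by `u`), the
second factor acting on the first by inversion. -/
abbrev InfDihedralLikeGroup : Type :=
  SemidirectProduct (Multiplicative ℤ) (Multiplicative ℤ)
    (zpowersHom (MulAut (Multiplicative ℤ)) (MulEquiv.inv (Multiplicative ℤ)))

namespace LaurentPolynomial

theorem algHom_ext_T_one {k B : Type*} [CommRing k] [Semiring B] [Algebra k B]
    {f g : LaurentPolynomial k →ₐ[k] B} (h : f (T 1) = g (T 1)) : f = g := by
  refine (AddMonoidAlgebra.lift k B ℤ).symm.injective (MonoidHom.ext_mint ?_)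
  exact h

/-- Inversion is the only algebra automorphism of `k[h^{±1}]` sending `h` to `h⁻¹`. -/
theorem eq_invert_of_apply_T_one {k : Type*} [CommRing k]
    {σ : LaurentPolynomial k ≃ₐ[k] LaurentPolynomial k} (hσ : σ (T 1) = T (-1)) : σ = invert :=
  AlgEquiv.coe_toAlgHom_injective (algHom_ext_T_one (by simpa using hσ))

end LaurentPolynomial

namespace GWA

variable {k : Type*} [CommRing k] (σ : LaurentPolynomial k ≃ₐ[k] LaurentPolynomial k)
  (a : LaurentPolynomial k)

/-- The structure map `k[h^{±1}] → k[h^{±1}](σ, a)` as an algebra homomorphism. -/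
noncomputable def rHom : LaurentPolynomial k →ₐ[k] GWA k σ a :=
  AlgHom.ofLinearMap
    { toFun := r σ a
      map_add' := fun p q ↦ by
        simpa only [r, map_add] using RingQuot.mkAlgHom_rel k (GWARel.add p q)
      map_smul' := fun c p ↦ by
        simpa only [r, map_smul, RingHom.id_apply] using
          RingQuot.mkAlgHom_rel k (GWARel.smul (σ := σ) (a := a) c p) }
    ((RingQuot.mkAlgHom_rel k GWARel.one).trans (map_one _))
    fun p q ↦ (RingQuot.mkAlgHom_rel k (GWARel.mul p q)).trans (map_mul _ _ _)

theorem x_mul_rHom (p : LaurentPolynomial k) :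
    x σ a * rHom σ a p = rHom σ a (σ p) * x σ a := by
  exact (map_mul _ _ _).symm.trans
    ((RingQuot.mkAlgHom_rel k (GWARel.xr p)).trans (map_mul _ _ _))

theorem y_mul_x : y σ a * x σ a = rHom σ a a := 
  (map_mul _ _ _).symm.trans (RingQuot.mkAlgHom_rel k GWARel.yx)

theorem x_mul_y : x σ a * y σ a = rHom σ a (σ a) := 
  (map_mul _ _ _).symm.trans (RingQuot.mkAlgHom_rel k GWARel.xy)

variable {σ a} {B : Type*} [Ring B] [Algebra k B]

/-- The universal property of the generalized Weyl algebra. -/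
noncomputable def lift (f : LaurentPolynomial k →ₐ[k] B) (X Y : B)
    (hxr : ∀ p, X * f p = f (σ p) * X) (hyr : ∀ p, Y * f p = f (σ.symm p) * Y)
    (hyx : Y * X = f a) (hxy : X * Y = f (σ a)) : GWA k σ a →ₐ[k] B :=
  RingQuot.liftAlgHom k ⟨FreeAlgebra.lift k (Sum.elim f ![X, Y]), fun s t h ↦ by
    cases h <;> simp [hxr, hyr, hyx, hxy]⟩

section lift

variable (f : LaurentPolynomial k →ₐ[k] B) (X Y : B)
    (hxr : ∀ p, X * f p = f (σ p) * X) (hyr : ∀ p, Y * f p = f (σ.symm p) * Y)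
    (hyx : Y * X = f a) (hxy : X * Y = f (σ a))

@[simp]
theorem lift_rHom (p : LaurentPolynomial k) :
    lift f X Y hxr hyr hyx hxy (rHom σ a p) = f p :=
  (RingQuot.liftAlgHom_mkAlgHom_apply k _ _ _).trans (by simp)

@[simp]
theorem lift_x : lift f X Y hxr hyr hyx hxy (x σ a) = X :=
  (RingQuot.liftAlgHom_mkAlgHom_apply k _ _ _).trans (by simp)

@[simp]
theorem lift_y : lift f X Y hxr hyr hyx hxy (y σ a) = Y :=
  (RingQuot.liftAlgHom_mkAlgHom_apply k _ _ _).trans (by simp)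

end lift

theorem algHom_ext {f g : GWA k σ a →ₐ[k] B}
    (hr : f (rHom σ a (T 1)) = g (rHom σ a (T 1)))
    (hx : f (x σ a) = g (x σ a)) (hy : f (y σ a) = g (y σ a)) : f = g := by
  have hr' : f.comp (rHom σ a) = g.comp (rHom σ a) := algHom_ext_T_one hr
  refine RingQuot.ringQuot_ext' k f g (FreeAlgebra.hom_ext (funext ?_))
  rintro (p | i)
  · exact DFunLike.congr_fun hr' p
  · fin_cases i
    · exact hx
    · exact hy

end GWA

namespace InfDihedralLikeGroup

open Multiplicative SemidirectProduct

/-- The generator `u`, acting on `v` by inversion. -/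
def u : InfDihedralLikeGroup := inr (ofAdd 1)

/-- The generator `v`. -/
def v : InfDihedralLikeGroup := inl (ofAdd 1)

theorem u_mul_inl (n : Multiplicative ℤ) : u * inl n = inl n⁻¹ * u := by
  ext <;> simp [u]

theorem u_inv_mul_inl (n : Multiplicative ℤ) : u⁻¹ * inl n = inl n⁻¹ * u⁻¹ := by
  rw [inv_mul_eq_iff_eq_mul, ← mul_assoc, u_mul_inl, inv_inv, mul_inv_cancel_right]

theorem monoidHom_ext {M : Type*} [Monoid M] {f g : InfDihedralLikeGroup →* M}
    (hu : f u = g u) (hv : f v = g v) : f = g := by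
  have hl : f.comp inl = g.comp inl := MonoidHom.ext_mint hv
  have hr : f.comp inr = g.comp inr := MonoidHom.ext_mint hu
  ext w
  rw [← inl_left_mul_inr_right w, map_mul, map_mul]
  exact congrArg₂ _ (DFunLike.congr_fun hl _) (DFunLike.congr_fun hr _)

section lift

variable {H : Type*} [Group H]

/-- The universal property of `⟨u, v | u v u⁻¹ = v⁻¹⟩`. -/
def lift (U V : H) (h : U * V * U⁻¹ = V⁻¹) : InfDihedralLikeGroup →* H :=
  SemidirectProduct.lift (zpowersHom H V) (zpowersHom H U) fun g ↦ by
    refine MonoidHom.ext_mint ?_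
    induction g using Multiplicative.rec with | _ n
    induction n using Int.induction_on with
    | zero => simp
    | succ n ih =>
      simp [zpow_add] at ih ⊢
      rw [ih, ← map_inv, ← h, map_mul, map_mul, map_inv]
    | pred n ih =>
      have h' : V⁻¹ = U⁻¹ * V * U := by
        rw [mul_assoc, eq_inv_mul_iff_mul_eq, ← mul_inv_eq_iff_eq_mul]
        simpa [mul_assoc] using congrArg (·⁻¹) h
      simp [zpow_sub] at ih ⊢
      rw [ih, ← map_inv, h', map_mul, map_mul, map_inv]

variable (U V : H) (h : U * V * U⁻¹ = V⁻¹)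

@[simp]
theorem lift_u : lift U V h u = U := by simp [lift, u]

@[simp]
theorem lift_v : lift U V h v = V := by simp [lift, v]

end lift

end InfDihedralLikeGroup

namespace GWA

variable {k : Type*} [CommRing k]

open InfDihedralLikeGroup

section toGroupAlgebra

/-- The embedding `k[v^{±1}] → k[G]`. -/
noncomputable def laurentToGroupAlgebra :
    LaurentPolynomial k →ₐ[k] MonoidAlgebra k InfDihedralLikeGroup :=
  AddMonoidAlgebra.lift k _ ℤ ((MonoidAlgebra.of k _).comp SemidirectProduct.inl)

theorem laurentToGroupAlgebra_T_one :
    laurentToGroupAlgebra (T 1 : LaurentPolynomial k) = MonoidAlgebra.of k _ v := by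
  rw [laurentToGroupAlgebra, T, AddMonoidAlgebra.lift_single, one_smul]
  rfl

theorem of_mul_laurentToGroupAlgebra {w : InfDihedralLikeGroup}
    (hw : ∀ n, w * SemidirectProduct.inl n = SemidirectProduct.inl n⁻¹ * w)
    (p : LaurentPolynomial k) :
    MonoidAlgebra.of k _ w * laurentToGroupAlgebra p =
      laurentToGroupAlgebra (invert p) * MonoidAlgebra.of k _ w := by
  induction p using LaurentPolynomial.induction_on' with
  | add p q hp hq => simp only [map_add, mul_add, add_mul, hp, hq]
  | C_mul_T n c =>
    rw [← smul_eq_C_mul, map_smul, map_smul, map_smul, mul_smul_comm, smul_mul_assoc, invert_T]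
    congr 1
    simp only [laurentToGroupAlgebra, T, AddMonoidAlgebra.lift_single, one_smul,
      MonoidHom.comp_apply, ← map_mul, hw, ofAdd_neg]

/-- The map `k[h^{±1}](σ_inv, a) → k[G]` given by `h ↦ v`, `x ↦ u`, `y ↦ a(v) u⁻¹`. -/
noncomputable def toGroupAlgebra (a : LaurentPolynomial k) :
    GWA k invert a →ₐ[k] MonoidAlgebra k InfDihedralLikeGroup :=
  lift laurentToGroupAlgebra (MonoidAlgebra.of k _ u)
    (laurentToGroupAlgebra a * MonoidAlgebra.of k _ u⁻¹)
    (of_mul_laurentToGroupAlgebra u_mul_inl)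
    (fun p ↦ by
      rw [mul_assoc, of_mul_laurentToGroupAlgebra u_inv_mul_inl, ← mul_assoc, ← mul_assoc,
        ← map_mul, ← map_mul, mul_comm a, invert_symm])
    (by rw [mul_assoc, ← map_mul, inv_mul_cancel, map_one, mul_one])
    (by rw [← mul_assoc, of_mul_laurentToGroupAlgebra u_mul_inl, mul_assoc, ← map_mul,
      mul_inv_cancel, map_one, mul_one])

end toGroupAlgebra

section ofGroupAlgebra

variable (σ : LaurentPolynomial k ≃ₐ[k] LaurentPolynomial k) (a : (LaurentPolynomial k)ˣ)

/-- If `a` is invertible then so is `x`, with inverse `a⁻¹ y`. -/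
noncomputable def xUnit : (GWA k σ a)ˣ where
  val := x σ a
  inv := rHom σ a ↑a⁻¹ * y σ a
  val_inv := by
    rw [← mul_assoc, x_mul_rHom, mul_assoc, x_mul_y, ← map_mul, ← map_mul, a.inv_mul, map_one,
      map_one]
  inv_val := by rw [mul_assoc, y_mul_x, ← map_mul, a.inv_mul, map_one]

/-- The element `h` as a unit of the generalized Weyl algebra. -/
noncomputable def hUnit : (GWA k σ a)ˣ where
  val := rHom σ a (T 1)
  inv := rHom σ a (T (-1))
  val_inv := by rw [← map_mul, ← T_add]; exact map_one _
  inv_val := by rw [← map_mul, ← T_add]; exact map_one _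

/-- The map `k[G] → k[h^{±1}](σ_inv, a)` given by `v ↦ h`, `u ↦ x`, for `a` invertible. -/
noncomputable def ofGroupAlgebra :
    MonoidAlgebra k InfDihedralLikeGroup →ₐ[k] GWA k invert (a : LaurentPolynomial k) :=
  MonoidAlgebra.lift k _ _ ((Units.coeHom _).comp
    (InfDihedralLikeGroup.lift (xUnit invert a) (hUnit invert a) (by
      rw [mul_inv_eq_iff_eq_mul]
      ext
      exact (x_mul_rHom invert (a : LaurentPolynomial k) (T 1)).trans
        (congrArg (rHom _ _ · * _) (invert_T 1)))))

theorem ofGroupAlgebra_of_u : ofGroupAlgebra a (MonoidAlgebra.of k _ u) = 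
    x invert (a : LaurentPolynomial k) := by
  rw [ofGroupAlgebra, MonoidAlgebra.lift_of, MonoidHom.comp_apply, lift_u]
  rfl

theorem ofGroupAlgebra_of_u_inv : ofGroupAlgebra a (MonoidAlgebra.of k _ u⁻¹) =
    rHom invert (a : LaurentPolynomial k) ↑a⁻¹ * y invert (a : LaurentPolynomial k) := by
  rw [ofGroupAlgebra, MonoidAlgebra.lift_of, MonoidHom.comp_apply, map_inv, lift_u]
  rfl

theorem ofGroupAlgebra_of_v :
    ofGroupAlgebra a (MonoidAlgebra.of k _ v) = rHom invert (a : LaurentPolynomial k) (T 1) := by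
  rw [ofGroupAlgebra, MonoidAlgebra.lift_of, MonoidHom.comp_apply, lift_v]
  rfl

theorem ofGroupAlgebra_comp_laurentToGroupAlgebra :
    (ofGroupAlgebra a).comp laurentToGroupAlgebra = rHom invert (a : LaurentPolynomial k) :=
  algHom_ext_T_one (by
    rw [AlgHom.comp_apply, laurentToGroupAlgebra_T_one, ofGroupAlgebra_of_v])

end ofGroupAlgebra

theorem groupAlgebra_algHom_ext {B : Type*} [Semiring B] [Algebra k B]
    {f g : MonoidAlgebra k InfDihedralLikeGroup →ₐ[k] B}
    (hu : f (MonoidAlgebra.of k _ u) = g (MonoidAlgebra.of k _ u))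
    (hv : f (MonoidAlgebra.of k _ v) = g (MonoidAlgebra.of k _ v)) : f = g :=
  (MonoidAlgebra.lift k B _).symm.injective (monoidHom_ext hu hv)

/-- For `a` invertible, `k[h^{±1}](σ_inv, a)` is the group algebra of `⟨u, v | u v u⁻¹ = v⁻¹⟩`. -/
noncomputable def equivGroupAlgebra (a : (LaurentPolynomial k)ˣ) :
    GWA k invert (a : LaurentPolynomial k) ≃ₐ[k] MonoidAlgebra k InfDihedralLikeGroup :=
  AlgEquiv.ofAlgHom (toGroupAlgebra (a : LaurentPolynomial k)) (ofGroupAlgebra a)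
    (groupAlgebra_algHom_ext
      (by rw [AlgHom.comp_apply, ofGroupAlgebra_of_u, toGroupAlgebra, lift_x, AlgHom.id_apply])
      (by rw [AlgHom.comp_apply, ofGroupAlgebra_of_v, toGroupAlgebra, lift_rHom,
        laurentToGroupAlgebra_T_one, AlgHom.id_apply]))
    (algHom_ext
      (by rw [AlgHom.comp_apply, toGroupAlgebra, lift_rHom, laurentToGroupAlgebra_T_one,
        ofGroupAlgebra_of_v, AlgHom.id_apply])
      (by rw [AlgHom.comp_apply, toGroupAlgebra, lift_x, ofGroupAlgebra_of_u, AlgHom.id_apply])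
      (by rw [AlgHom.comp_apply, toGroupAlgebra, lift_y, map_mul, ofGroupAlgebra_of_u_inv,
        ← AlgHom.comp_apply, ofGroupAlgebra_comp_laurentToGroupAlgebra, ← mul_assoc, ← map_mul,
        a.mul_inv, map_one, one_mul, AlgHom.id_apply]))

end GWA

/-- For `a = a₁ hⁱ` a monomial with `a₁ ∈ k^*`, the generalized Weyl algebra
`k[h^{±1}](σ_inv, a)` with `σ_inv(h) = h⁻¹` is isomorphic to the skew Laurent ring
`k[v^{±1}][u^{±1}; σ]`, `σ(v) = v⁻¹`, i.e. to the group algebra `k[ℤ ⋊ ℤ]` of the group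
generated by `u, v` subject to `u v u⁻¹ = v⁻¹`. -/
theorem involution_gwa_monomial_group_algebra (k : Type*) [Field k]
    (a₁ : k) (ha₁ : a₁ ≠ 0) (i : ℤ)
    (σ : LaurentPolynomial k ≃ₐ[k] LaurentPolynomial k) (hσ : σ (T 1) = T (-1)) :
    Nonempty (GWA k σ (C a₁ * T i) ≃ₐ[k] MonoidAlgebra k InfDihedralLikeGroup) := by
  obtain rfl := eq_invert_of_apply_T_one hσ
  have ha : IsUnit (C a₁ * T i) := ((isUnit_iff_ne_zero.2 ha₁).map C).mul (isUnit_T i)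
  exact ⟨GWA.equivGroupAlgebra ha.unit⟩
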